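/- arXiv:2302.07812 — 7 statements merged into one kernel-verified Lean document; each statement's English description precedes it below -/
import Mathlib

section
/- Let A and B be commutative unital Banach algebras and let T : A → B be a continuous algebra homomorphism with dense range. If A is strongly regular, then B is strongly regular. -/
open WeakDual Topology

namespace VV

variable (B : Type*) [NormedCommRing B] [NormedAlgebra ℂ B]

/-- The ideal `I_ψ = {b | ψ b = 0}`. -/
def Iid (ψ : characterSpace ℂ B) : Set B := {b : B | ψ b = 0}

/-- The ideal `J_ψ` of elements whose Gelfand transform vanishes on a
neighbourhood of `ψ`. -/
def Jid (ψ : characterSpace ℂ B) : Set B :=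
  {b : B | ∃ U ∈ nhds ψ, ∀ χ ∈ U, χ b = 0}

/-- Regularity of a commutative Banach algebra. -/
def IsRegular : Prop :=
  ∀ E : Set (characterSpace ℂ B), IsClosed E →
    ∀ ψ₀ ∉ E, ∃ b : B, ψ₀ b ≠ 0 ∧ ∀ ψ ∈ E, ψ b = 0

def IsStronglyRegularAt (ψ : characterSpace ℂ B) : Prop :=
  Iid B ψ ⊆ closure (Jid B ψ)

def IsStronglyRegular : Prop := ∀ ψ : characterSpace ℂ B, IsStronglyRegularAt B ψ

/-- Bounded relative units at a character. -/
def HasBRUAt (ψ : characterSpace ℂ B) : Prop :=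
  ∃ M : ℝ, 0 < M ∧ ∀ K : Set (characterSpace ℂ B), IsCompact K → ψ ∉ K →
    ∃ b ∈ Jid B ψ, (∀ χ ∈ K, χ b = 1) ∧ ‖b‖ ≤ M

def HasBRU : Prop := ∀ ψ : characterSpace ℂ B, HasBRUAt B ψ

/-- Ditkin's condition at a character: `b ∈ closure (b • J_ψ)` for every `b ∈ I_ψ`. -/
def DitkinAt (ψ : characterSpace ℂ B) : Prop :=
  ∀ b ∈ Iid B ψ, b ∈ closure ((fun u => b * u) '' Jid B ψ)

def IsDitkin : Prop := ∀ ψ : characterSpace ℂ B, DitkinAt B ψ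

/-- `I` has a bounded approximate identity contained in `J`: a bounded net `(u_i)`
in `J` with `‖b * u_i - b‖ → 0` for every `b ∈ I`. -/
def HasBAI (I J : Set B) : Prop :=
  ∃ (ι : Type) (le : ι → ι → Prop) (u : ι → B) (M : ℝ),
    Nonempty ι ∧ (∀ i j : ι, ∃ k, le i k ∧ le j k) ∧
    (∀ i, u i ∈ J) ∧ (∀ i, ‖u i‖ ≤ M) ∧
    ∀ b ∈ I, ∀ ε : ℝ, 0 < ε → ∃ i, ∀ j, le i j → ‖b * u j - b‖ < ε

/-- Strong Ditkin's condition at `ψ`. -/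
def StrongDitkinAt (ψ : characterSpace ℂ B) : Prop := HasBAI B (Iid B ψ) (Jid B ψ)

def IsStrongDitkin : Prop := ∀ ψ : characterSpace ℂ B, StrongDitkinAt B ψ

/-- Normality. -/
def IsNormal : Prop :=
  ∀ E : Set (characterSpace ℂ B), IsClosed E → E ≠ Set.univ →
    ∀ F : Set (characterSpace ℂ B), IsCompact F → (∀ ψ ∈ F, ψ ∉ E) →
      ∃ b : B, (∀ ψ ∈ F, ψ b = 1) ∧ ∀ ψ ∈ E, ψ b = 0

/-- Semisimplicity: the Gelfand transform is injective. -/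
def IsSemisimple : Prop :=
  ∀ b : B, (∀ ψ : characterSpace ℂ B, ψ b = 0) → b = 0

end VV

namespace VV

open WeakDual.CharacterSpace

variable {A B : Type*} [NormedCommRing A] [NormedAlgebra ℂ A]
  [NormedCommRing B] [NormedAlgebra ℂ B]

/-- The pullback of a character along a continuous unital algebra homomorphism. -/
noncomputable def characterPullback (T : A →ₐ[ℂ] B) (hT : Continuous T)
    (ψ : characterSpace ℂ B) : characterSpace ℂ A :=
  ⟨StrongDual.toWeakDual ((WeakDual.toStrongDual (ψ : WeakDual ℂ B)).comp ⟨T.toLinearMap, hT⟩), by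
    refine ⟨fun h => ?_, fun x y => ?_⟩
    · have h1 : ψ (T 1) = 0 := DFunLike.congr_fun h 1
      simp at h1
    · change ψ (T (x * y)) = ψ (T x) * ψ (T y)
      simp⟩

@[simp]
theorem characterPullback_apply (T : A →ₐ[ℂ] B) (hT : Continuous T)
    (ψ : characterSpace ℂ B) (a : A) : characterPullback T hT ψ a = ψ (T a) := rfl

theorem continuous_characterPullback (T : A →ₐ[ℂ] B) (hT : Continuous T) :
    Continuous (characterPullback T hT) :=
  Continuous.subtype_mk (WeakDual.continuous_of_continuous_eval fun a =>
    (WeakDual.eval_continuous (T a)).comp continuous_subtype_val) _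

theorem mapsTo_Jid (T : A →ₐ[ℂ] B) (hT : Continuous T) (ψ : characterSpace ℂ B) :
    Set.MapsTo T (Jid A (characterPullback T hT ψ)) (Jid B ψ) := by
  rintro a ⟨U, hU, ha⟩
  exact ⟨_, (continuous_characterPullback T hT).continuousAt hU, fun χ hχ => ha _ hχ⟩

theorem Iid_subset_closure_image (T : A →ₐ[ℂ] B) (hT : Continuous T) (hd : DenseRange T)
    (ψ : characterSpace ℂ B) :
    Iid B ψ ⊆ closure (T '' Iid A (characterPullback T hT ψ)) := by
  intro b hb
  have hψ : Continuous ψ := map_continuous ψ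
  have hg : Continuous fun c : B => c - ψ c • (1 : B) := by fun_prop
  have hb0 : ψ b = 0 := hb
  have key := map_mem_closure (t := T '' Iid A (characterPullback T hT ψ)) hg (hd b) <| by
    rintro _ ⟨a, rfl⟩
    refine ⟨a - ψ (T a) • 1, ?_, by simp⟩
    change ψ (T (a - ψ (T a) • 1)) = 0
    simp
  simpa [hb0] using key

theorem IsStronglyRegularAt.of_characterPullback (T : A →ₐ[ℂ] B) (hT : Continuous T)
    (hd : DenseRange T) {ψ : characterSpace ℂ B}
    (h : IsStronglyRegularAt A (characterPullback T hT ψ)) : IsStronglyRegularAt B ψ := by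
  refine (Iid_subset_closure_image T hT hd ψ).trans (closure_minimal ?_ isClosed_closure)
  rintro _ ⟨a, ha, rfl⟩
  exact map_mem_closure hT (h ha) (mapsTo_Jid T hT ψ)

end VV

theorem stronglyRegular_of_denseRange_hom
    (A : Type*) [NormedCommRing A] [NormedAlgebra ℂ A] [CompleteSpace A] [Nontrivial A]
    (B : Type*) [NormedCommRing B] [NormedAlgebra ℂ B] [CompleteSpace B] [Nontrivial B]
    (T : A →ₐ[ℂ] B) (hTcont : Continuous T) (hTdense : DenseRange T)
    (hA : VV.IsStronglyRegular A) : VV.IsStronglyRegular B :=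
  fun ψ => (hA (VV.characterPullback T hTcont ψ)).of_characterPullback T hTcont hTdense
end

section
/- Let A and B be commutative unital Banach algebras and let T : A → B be a continuous algebra homomorphism with dense range. If A admits bounded relative units, then B admits bounded relative units. -/
open WeakDual Topology

namespace VV

/-- The pullback of a character along a continuous unital algebra homomorphism. -/
noncomputable def characterComap {A B : Type*} [NormedCommRing A] [NormedAlgebra ℂ A]
    [NormedCommRing B] [NormedAlgebra ℂ B] (T : A →ₐ[ℂ] B) (hT : Continuous T)
    (ψ : characterSpace ℂ B) : characterSpace ℂ A :=
  ⟨(ψ : WeakDual ℂ B).comp (⟨T.toLinearMap, hT⟩ : A →L[ℂ] B), by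
    refine ⟨fun h => ?_, fun x y => ?_⟩
    · have h1 : ψ (T 1) = 0 := DFunLike.congr_fun h (1 : A)
      rw [map_one, map_one] at h1
      exact one_ne_zero h1
    · change ψ (T (x * y)) = ψ (T x) * ψ (T y)
      rw [map_mul, map_mul]⟩

section characterComap

variable {A B : Type*} [NormedCommRing A] [NormedAlgebra ℂ A]
  [NormedCommRing B] [NormedAlgebra ℂ B] (T : A →ₐ[ℂ] B) (hT : Continuous T)

@[simp]
theorem characterComap_apply (ψ : characterSpace ℂ B) (a : A) :
    characterComap T hT ψ a = ψ (T a) := rfl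

theorem continuous_characterComap : Continuous (characterComap T hT) := by
  refine Continuous.subtype_mk (WeakDual.continuous_of_continuous_eval fun a => ?_) _
  exact (WeakDual.eval_continuous (T a)).comp continuous_subtype_val

theorem characterComap_injective (hTdense : DenseRange T) :
    Function.Injective (characterComap T hT) := by
  intro ψ χ h
  refine DFunLike.coe_injective (hTdense.equalizer (map_continuous ψ) (map_continuous χ) ?_)
  funext a
  exact DFunLike.congr_fun h a

theorem map_mem_Jid {ψ : characterSpace ℂ B} {a : A} (ha : a ∈ Jid A (characterComap T hT ψ)) :
    T a ∈ Jid B ψ := by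
  obtain ⟨U, hU, hvanish⟩ := ha
  exact ⟨_, (continuous_characterComap T hT).continuousAt hU, fun χ hχ => hvanish _ hχ⟩

theorem HasBRUAt.map (hTdense : DenseRange T) {ψ : characterSpace ℂ B}
    (hA : HasBRUAt A (characterComap T hT ψ)) : HasBRUAt B ψ := by
  obtain ⟨M, hM, h⟩ := hA
  let S : A →L[ℂ] B := ⟨T.toLinearMap, hT⟩
  refine ⟨‖S‖ * M + 1, by positivity, fun K hK hψ => ?_⟩
  obtain ⟨a, haJ, ha1, haM⟩ := h (characterComap T hT '' K)
    (hK.image (continuous_characterComap T hT))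
    (by rwa [(characterComap_injective T hT hTdense).mem_set_image])
  refine ⟨T a, map_mem_Jid T hT haJ, fun χ hχ => ha1 _ (Set.mem_image_of_mem _ hχ), ?_⟩
  calc ‖T a‖ ≤ ‖S‖ * ‖a‖ := S.le_opNorm a
    _ ≤ ‖S‖ * M := by gcongr
    _ ≤ ‖S‖ * M + 1 := by linarith

end characterComap

end VV

theorem boundedRelativeUnits_of_denseRange_hom
    (A : Type*) [NormedCommRing A] [NormedAlgebra ℂ A] [CompleteSpace A] [Nontrivial A]
    (B : Type*) [NormedCommRing B] [NormedAlgebra ℂ B] [CompleteSpace B] [Nontrivial B]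
    (T : A →ₐ[ℂ] B) (hTcont : Continuous T) (hTdense : DenseRange T)
    (hA : VV.HasBRU A) : VV.HasBRU B := by
  exact fun ψ => (hA (VV.characterComap T hTcont ψ)).map T hTcont hTdense
end

section
/- Let A and B be commutative unital Banach algebras and let T : A → B be a continuous surjective algebra homomorphism. If A satisfies Ditkin's condition (i.e., A is a Ditkin algebra), then B satisfies Ditkin's condition. -/
open WeakDual Topology

/-- Pullback of characters along a continuous unital algebra homomorphism. -/
noncomputable def VV.pullback {A B : Type*} [NormedCommRing A] [NormedAlgebra ℂ A]
    [NormedCommRing B] [NormedAlgebra ℂ B] (T : A →ₐ[ℂ] B) (hT : Continuous T)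
    (ψ : characterSpace ℂ B) : characterSpace ℂ A :=
  ⟨(CharacterSpace.toCLM ψ).comp (⟨T.toLinearMap, hT⟩ : A →L[ℂ] B), by
    refine ⟨fun h => ?_, fun x y => ?_⟩
    · have h1 : ψ (T 1) = 0 := DFunLike.congr_fun h (1 : A)
      simp at h1
    · change ψ (T (x * y)) = ψ (T x) * ψ (T y)
      simp⟩

theorem VV.pullback_apply {A B : Type*} [NormedCommRing A] [NormedAlgebra ℂ A]
    [NormedCommRing B] [NormedAlgebra ℂ B] (T : A →ₐ[ℂ] B) (hT : Continuous T)
    (ψ : characterSpace ℂ B) (a : A) : VV.pullback T hT ψ a = ψ (T a) := rfl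

theorem VV.continuous_pullback {A B : Type*} [NormedCommRing A] [NormedAlgebra ℂ A]
    [NormedCommRing B] [NormedAlgebra ℂ B] (T : A →ₐ[ℂ] B) (hT : Continuous T) :
    Continuous (VV.pullback T hT) :=
  Continuous.subtype_mk (WeakDual.continuous_of_continuous_eval fun a =>
    (WeakDual.eval_continuous (T a)).comp continuous_subtype_val) _

theorem ditkin_of_surjective_hom
    (A : Type*) [NormedCommRing A] [NormedAlgebra ℂ A] [CompleteSpace A] [Nontrivial A]
    (B : Type*) [NormedCommRing B] [NormedAlgebra ℂ B] [CompleteSpace B] [Nontrivial B]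
    (T : A →ₐ[ℂ] B) (hTcont : Continuous T) (hTsurj : Function.Surjective T)
    (hA : VV.IsDitkin A) : VV.IsDitkin B := by
  intro ψ b hb
  obtain ⟨a, rfl⟩ := hTsurj b
  refine map_mem_closure hTcont (hA (VV.pullback T hTcont ψ) a hb) ?_
  rintro _ ⟨u, ⟨U, hU, hu⟩, rfl⟩
  exact ⟨T u, ⟨_, (VV.continuous_pullback T hTcont).continuousAt hU,
    fun χ hχ => VV.pullback_apply T hTcont χ u ▸ hu _ hχ⟩, (map_mul T a u).symm⟩
end

section
/- Let X be a compact Hausdorff space, A a semisimple commutative unital Banach algebra, and 𝑨 an admissible Banach A-valued function algebra on X with 𝔄 = 𝑨 ∩ C(X). If 𝑨 is regular then both 𝔄 and A are regular, and if 𝑨 is strongly regular then both 𝔄 and A are strongly regular. -/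
open WeakDual Topology

namespace VV

variable (B : Type*) [NormedCommRing B] [NormedAlgebra ℂ B]

variable (X : Type*) [TopologicalSpace X] [CompactSpace X] [T2Space X]
variable (A : Type*) [NormedCommRing A] [NormedAlgebra ℂ A] [CompleteSpace A] [Nontrivial A]

section FunctionAlgebra

variable (B : Type*) [NormedCommRing B] [NormedAlgebra ℂ B] [CompleteSpace B] [Nontrivial B]

/-- `𝑨` contains the constant functions. -/
def ContainsConstants (ι : B →ₐ[ℂ] C(X, A)) : Prop :=
  ∀ a : A, ∃ b : B, ∀ x : X, ι b x = a

/-- `𝑨` separates the points of `X`. -/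
def Separates (ι : B →ₐ[ℂ] C(X, A)) : Prop :=
  ∀ x y : X, x ≠ y → ∃ b : B, ι b x ≠ ι b y

/-- Admissibility: `φ ∘ f ∈ 𝑨` whenever `f ∈ 𝑨` and `φ ∈ Φ(A)`. -/
def Admissible (ι : B →ₐ[ℂ] C(X, A)) : Prop :=
  ∀ (f : B) (φ : characterSpace ℂ A), ∃ g : B,
    ∀ x : X, ι g x = algebraMap ℂ A (φ (ι f x))

/-- The subalgebra `𝔄 = 𝑨 ∩ C(X)` of scalar-valued members of `𝑨`. -/
def scalarSub (ι : B →ₐ[ℂ] C(X, A)) : Subalgebra ℂ B where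
  carrier := {b : B | ∀ x : X, ∃ c : ℂ, ι b x = algebraMap ℂ A c}
  mul_mem' := by
    intro b b' hb hb' x
    obtain ⟨c, hc⟩ := hb x
    obtain ⟨c', hc'⟩ := hb' x
    refine ⟨c * c', ?_⟩
    rw [map_mul, ContinuousMap.mul_apply, hc, hc', map_mul]
  add_mem' := by
    intro b b' hb hb' x
    obtain ⟨c, hc⟩ := hb x
    obtain ⟨c', hc'⟩ := hb' x
    refine ⟨c + c', ?_⟩
    rw [map_add, ContinuousMap.add_apply, hc, hc', map_add]
  algebraMap_mem' := by
    intro r x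
    refine ⟨r, ?_⟩
    rw [AlgHom.commutes]
    simp [Algebra.algebraMap_eq_smul_one]

/-- `𝑨` is an `A`-valued uniform algebra: its norm is equivalent to the sup norm. -/
def IsUniform (ι : B →ₐ[ℂ] C(X, A)) : Prop :=
  ∃ c C : ℝ, 0 < c ∧ ∀ b : B, c * ‖ι b‖ ≤ ‖b‖ ∧ ‖b‖ ≤ C * ‖ι b‖

/-- Every character of `𝑨` is of the form `ψ ⋄ φ`. -/
def NaturalProduct (ι : B →ₐ[ℂ] C(X, A)) : Prop :=
  ∀ τ : characterSpace ℂ B,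
    ∃ (ψ : characterSpace ℂ (scalarSub X A B ι)) (φ : characterSpace ℂ A),
      ∀ (f : B) (g : scalarSub X A B ι),
        (∀ x : X, ι (g : B) x = algebraMap ℂ A (φ (ι f x))) → τ f = ψ g

end FunctionAlgebra

end VV

namespace VV

section CharacterPullback

variable {R S : Type*} [NormedCommRing R] [NormedAlgebra ℂ R]
  [NormedCommRing S] [NormedAlgebra ℂ S]

/-- The pullback of a character along a continuous unital homomorphism. -/
noncomputable def pullback_s7 (s : R →A[ℂ] S) (τ : characterSpace ℂ S) : characterSpace ℂ R :=
  ⟨StrongDual.toWeakDual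
    ((WeakDual.toStrongDual (τ : WeakDual ℂ S)).comp s.toContinuousLinearMap), by
    rw [CharacterSpace.eq_set_map_one_map_mul]
    refine ⟨?_, fun x y => ?_⟩
    · change τ (s 1) = 1
      rw [map_one, map_one]
    · change τ (s (x * y)) = τ (s x) * τ (s y)
      rw [map_mul, map_mul]⟩

@[simp]
theorem pullback_apply_s7 (s : R →A[ℂ] S) (τ : characterSpace ℂ S) (r : R) :
    pullback_s7 s τ r = τ (s r) := rfl

theorem continuous_pullback_s7 (s : R →A[ℂ] S) : Continuous (pullback_s7 s) := by
  refine Continuous.subtype_mk (WeakDual.continuous_of_continuous_eval fun r => ?_) _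
  exact (WeakDual.eval_continuous (s r)).comp continuous_subtype_val

theorem pullback_pullback_of_leftInverse {s : R →A[ℂ] S} {p : S →A[ℂ] R}
    (h : Function.LeftInverse p s) (ψ : characterSpace ℂ R) :
    pullback_s7 s (pullback_s7 p ψ) = ψ := by
  ext r
  simp [h r]

/-- Regularity passes to retracts. -/
theorem IsRegular.of_retract {s : R →A[ℂ] S} {p : S →A[ℂ] R}
    (h : Function.LeftInverse p s) (hS : IsRegular S) : IsRegular R := by
  intro E hE ψ₀ hψ₀
  obtain ⟨b, hb₀, hb⟩ := hS _ (hE.preimage (continuous_pullback_s7 s)) (pullback_s7 p ψ₀)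
    (by simpa [pullback_pullback_of_leftInverse h] using hψ₀)
  exact ⟨p b, hb₀, fun ψ hψ => hb (pullback_s7 p ψ)
    (by simpa [pullback_pullback_of_leftInverse h] using hψ)⟩

/-- Strong regularity passes to retracts. -/
theorem IsStronglyRegular.of_retract {s : R →A[ℂ] S} {p : S →A[ℂ] R}
    (h : Function.LeftInverse p s) (hS : IsStronglyRegular S) : IsStronglyRegular R := by
  intro ψ b hb
  have hsb : s b ∈ Iid S (pullback_s7 p ψ) := by
    change ψ (p (s b)) = 0
    rw [h b]
    exact hb
  have hmaps : Set.MapsTo p (Jid S (pullback_s7 p ψ)) (Jid R ψ) := by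
    rintro f ⟨U, hU, hf⟩
    exact ⟨_, (continuous_pullback_s7 p).continuousAt hU, fun χ hχ => hf _ hχ⟩
  simpa only [h b] using map_mem_closure p.continuous (hS _ hsb) hmaps

/-- Homomorphisms from a Banach algebra into a semisimple one are continuous. -/
theorem IsSemisimple.continuous_algHom [CompleteSpace R] [CompleteSpace S]
    (hS : IsSemisimple S) (T : R →ₐ[ℂ] S) : Continuous T := by
  refine T.toLinearMap.continuous_of_seq_closed_graph fun u x y hu hTu => ?_
  rw [← sub_eq_zero]
  refine hS _ fun ψ => ?_
  have hψT : Continuous ((CharacterSpace.toAlgHom ψ).comp T) := map_continuous _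
  rw [map_sub, sub_eq_zero]
  exact tendsto_nhds_unique (((map_continuous ψ).tendsto y).comp hTu)
    ((hψT.tendsto x).comp hu)

end CharacterPullback

section FunctionAlgebra

variable {X : Type*} [TopologicalSpace X] {A : Type*} [NormedCommRing A] [NormedAlgebra ℂ A]
  {B : Type*} [NormedCommRing B] [NormedAlgebra ℂ B] {ι : B →ₐ[ℂ] C(X, A)}

/-- Evaluation of the elements of the function algebra at a point. -/
def evalHom (ι : B →ₐ[ℂ] C(X, A)) (x : X) : B →ₐ[ℂ] A :=
  (ContinuousMap.evalAlgHom ℂ A x).comp ι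

theorem nonempty_of_injective [Nontrivial B] (hinj : Function.Injective ι) : Nonempty X := by
  by_contra hX
  rw [not_nonempty_iff] at hX
  exact one_ne_zero (α := B) (hinj (by ext x; exact hX.elim x))

theorem isSemisimple_of_injective [CompleteSpace A] [CompleteSpace B]
    (hss : IsSemisimple A) (hinj : Function.Injective ι) : IsSemisimple B := by
  intro b hb
  refine hinj ?_
  ext x
  rw [map_zero]
  exact hss _ fun φ => hb (pullback_s7 ⟨evalHom ι x, hss.continuous_algHom _⟩ φ)

theorem exists_algHom_lift {R : Type*} [Semiring R] [Algebra ℂ R]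
    (hinj : Function.Injective ι) (F : R →ₐ[ℂ] C(X, A)) (hF : ∀ r, ∃ b, ι b = F r) :
    ∃ g : R →ₐ[ℂ] B, ∀ r, ι (g r) = F r := by
  refine ⟨(AlgEquiv.ofInjective ι hinj).symm.toAlgHom.comp (F.codRestrict ι.range hF),
    fun r => ?_⟩
  exact congrArg Subtype.val
    ((AlgEquiv.ofInjective ι hinj).apply_symm_apply (F.codRestrict ι.range hF r))

/-- The algebra `A` is a retract of every function algebra containing the constants. -/
theorem exists_retract_constants [CompactSpace X] [T2Space X] [CompleteSpace A] [Nontrivial A]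
    [CompleteSpace B] [Nontrivial B] (hss : IsSemisimple A) (hinj : Function.Injective ι)
    (hconst : ContainsConstants X A B ι) :
    ∃ (s : A →A[ℂ] B) (p : B →A[ℂ] A), Function.LeftInverse p s := by
  obtain ⟨x⟩ := nonempty_of_injective hinj
  obtain ⟨c, hc⟩ := exists_algHom_lift hinj (IsScalarTower.toAlgHom ℂ A C(X, A)) fun a => by
    obtain ⟨b, hb⟩ := hconst a
    refine ⟨b, ?_⟩
    ext x
    exact hb x
  refine ⟨⟨c, (isSemisimple_of_injective hss hinj).continuous_algHom c⟩,
    ⟨evalHom ι x, hss.continuous_algHom _⟩, fun a => ?_⟩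
  change ι (c a) x = a
  rw [hc]
  rfl

/-- The scalar-valued part of an admissible function algebra is a retract of it. -/
theorem exists_retract_scalarSub [CompactSpace X] [T2Space X] [CompleteSpace A] [Nontrivial A]
    [CompleteSpace B] [Nontrivial B] (hss : IsSemisimple A) (hinj : Function.Injective ι)
    (hadm : Admissible X A B ι) :
    ∃ (s : scalarSub X A B ι →A[ℂ] B) (p : B →A[ℂ] scalarSub X A B ι),
      Function.LeftInverse p s := by
  obtain ⟨φ⟩ : Nonempty (characterSpace ℂ A) := inferInstance
  obtain ⟨P, hP⟩ := exists_algHom_lift hinj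
    ((AlgHom.compLeftContinuous ℂ ((Algebra.ofId ℂ A).comp (CharacterSpace.toAlgHom φ))
      ((continuous_algebraMap ℂ A).comp (map_continuous φ))).comp ι) fun f => by
    obtain ⟨g, hg⟩ := hadm f φ
    refine ⟨g, ?_⟩
    ext x
    exact hg x
  have hPx (f : B) (x : X) : ι (P f) x = algebraMap ℂ A (φ (ι f x)) := by
    rw [hP]
    rfl
  have hPc : Continuous P := (isSemisimple_of_injective hss hinj).continuous_algHom P
  refine ⟨⟨(scalarSub X A B ι).val, continuous_subtype_val⟩,
    ⟨P.codRestrict _ fun f x => ⟨_, hPx f x⟩, hPc.subtype_mk _⟩, fun f => ?_⟩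
  refine Subtype.ext (hinj ?_)
  ext x
  change ι (P f) x = ι f x
  obtain ⟨c, hc⟩ := f.2 x
  have hφ : φ (algebraMap ℂ A c) = c := AlgHomClass.commutes φ c
  rw [hPx, hc, hφ]

end FunctionAlgebra

end VV

theorem regular_and_stronglyRegular_inherited
    (X : Type*) [TopologicalSpace X] [CompactSpace X] [T2Space X]
    (A : Type*) [NormedCommRing A] [NormedAlgebra ℂ A] [CompleteSpace A] [Nontrivial A]
    (hss : VV.IsSemisimple A)
    (B : Type*) [NormedCommRing B] [NormedAlgebra ℂ B] [CompleteSpace B] [Nontrivial B]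
    (ι : B →ₐ[ℂ] C(X, A)) (hinj : Function.Injective ι)
    (hconst : VV.ContainsConstants X A B ι) (hsep : VV.Separates X A B ι)
    (hadm : VV.Admissible X A B ι) :
    (VV.IsRegular B → VV.IsRegular (VV.scalarSub X A B ι) ∧ VV.IsRegular A) ∧
    (VV.IsStronglyRegular B →
      VV.IsStronglyRegular (VV.scalarSub X A B ι) ∧ VV.IsStronglyRegular A) := by
  obtain ⟨s, p, hA⟩ := VV.exists_retract_constants hss hinj hconst
  obtain ⟨s', p', hS⟩ := VV.exists_retract_scalarSub hss hinj hadm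
  exact ⟨fun h => ⟨h.of_retract hS, h.of_retract hA⟩,
    fun h => ⟨h.of_retract hS, h.of_retract hA⟩⟩
end

section
/- Let X be a compact Hausdorff space, A a semisimple commutative unital Banach algebra, and 𝑨 an admissible Banach A-valued function algebra on X with 𝔄 = 𝑨 ∩ C(X), such that every character of 𝑨 is of the form ψ⋄φ with ψ ∈ Φ(𝔄), φ ∈ Φ(A) (i.e., Φ(𝑨) = Φ(𝔄) × Φ(A)). If 𝔄 and A are regular, then 𝑨 is regular. -/
open WeakDual Topology

namespace VV

variable {X : Type*} [TopologicalSpace X]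
variable {A : Type*} [NormedCommRing A] [NormedAlgebra ℂ A]
variable {B : Type*} [NormedCommRing B] [NormedAlgebra ℂ B]

/-- `τ = ψ ⋄ φ`, i.e. `τ f = ψ (φ ∘ f)` for every `f ∈ 𝑨`. -/
def IsDiamond (ι : B →ₐ[ℂ] C(X, A)) (τ : characterSpace ℂ B)
    (ψ : characterSpace ℂ (scalarSub X A B ι)) (φ : characterSpace ℂ A) : Prop :=
  ∀ (f : B) (g : scalarSub X A B ι),
    (∀ x : X, ι (g : B) x = algebraMap ℂ A (φ (ι f x))) → τ f = ψ g

namespace IsDiamond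

variable {ι : B →ₐ[ℂ] C(X, A)} {τ τ' : characterSpace ℂ B}
  {ψ : characterSpace ℂ (scalarSub X A B ι)} {φ : characterSpace ℂ A}

/-- `ψ ⋄ φ` restricts to `ψ` on the scalar-valued functions. -/
theorem apply_scalar (h : IsDiamond ι τ ψ φ) (g : scalarSub X A B ι) : τ (g : B) = ψ g := by
  refine h g g fun x => ?_
  obtain ⟨c, hc⟩ := g.2 x
  rw [hc, AlgHomClass.commutes φ c, Algebra.algebraMap_self_apply]

/-- `ψ ⋄ φ` restricts to `φ` on the constant functions. -/
theorem apply_const (h : IsDiamond ι τ ψ φ) {a : A} {b : B} (hb : ∀ x : X, ι b x = a) :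
    τ b = φ a := by
  rw [h b (algebraMap ℂ _ (φ a)) fun x => ?_, AlgHomClass.commutes ψ,
    Algebra.algebraMap_self_apply]
  rw [hb, Subalgebra.coe_algebraMap, AlgHom.commutes]
  simp [Algebra.algebraMap_eq_smul_one]

/-- For an admissible algebra, the character `ψ ⋄ φ` is determined by `ψ` and `φ`. -/
theorem unique (hadm : Admissible X A B ι) (h : IsDiamond ι τ ψ φ) (h' : IsDiamond ι τ' ψ φ) :
    τ = τ' := by
  refine WeakDual.CharacterSpace.ext fun f => ?_
  obtain ⟨g, hg⟩ := hadm f φ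
  exact (h f ⟨g, fun x => ⟨_, hg x⟩⟩ hg).trans (h' f ⟨g, fun x => ⟨_, hg x⟩⟩ hg).symm

end IsDiamond

/-- A map into a character space is continuous if all its evaluations are. -/
theorem continuous_characterSpace_of_eval {T C : Type*} [TopologicalSpace T] [NormedCommRing C]
    [NormedAlgebra ℂ C] {F : T → characterSpace ℂ C} (h : ∀ c, Continuous fun t => F t c) :
    Continuous F :=
  (WeakDual.continuous_of_continuous_eval h).subtype_mk _

theorem continuous_eval {C : Type*} [NormedCommRing C] [NormedAlgebra ℂ C] (c : C) :
    Continuous fun χ : characterSpace ℂ C => χ c :=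
  (WeakDual.eval_continuous c).comp continuous_subtype_val

end VV

theorem regular_of_components
    (X : Type*) [TopologicalSpace X] [CompactSpace X] [T2Space X]
    (A : Type*) [NormedCommRing A] [NormedAlgebra ℂ A] [CompleteSpace A] [Nontrivial A]
    (hss : VV.IsSemisimple A)
    (B : Type*) [NormedCommRing B] [NormedAlgebra ℂ B] [CompleteSpace B] [Nontrivial B]
    (ι : B →ₐ[ℂ] C(X, A)) (hinj : Function.Injective ι)
    (hconst : VV.ContainsConstants X A B ι) (hsep : VV.Separates X A B ι)
    (hadm : VV.Admissible X A B ι) (hnat : VV.NaturalProduct X A B ι)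
    (hfA : VV.IsRegular (VV.scalarSub X A B ι)) (hA : VV.IsRegular A) :
    VV.IsRegular B := by
  intro E hE τ₀ hτ₀
  choose p q hpq using hnat
  replace hpq : ∀ τ, VV.IsDiamond ι τ (p τ) (q τ) := hpq
  have hp : Continuous p := VV.continuous_characterSpace_of_eval fun g => by
    simpa only [(hpq _).apply_scalar] using VV.continuous_eval (g : B)
  have hq : Continuous q := VV.continuous_characterSpace_of_eval fun a => by
    obtain ⟨b, hb⟩ := hconst a
    simpa only [(hpq _).apply_const hb] using VV.continuous_eval b
  have hclosed : IsClosed ((fun τ => (p τ, q τ)) '' E) :=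
    (hE.isCompact.image (hp.prodMk hq)).isClosed
  have hnotMem : (p τ₀, q τ₀) ∉ (fun τ => (p τ, q τ)) '' E := by
    rintro ⟨τ, hτ, heq⟩
    obtain ⟨h₁, h₂⟩ := Prod.mk.inj heq
    have hτ' := hpq τ
    rw [h₁, h₂] at hτ'
    exact hτ₀ (hτ'.unique hadm (hpq τ₀) ▸ hτ)
  obtain ⟨U, V, hU, hV, hpU, hqV, hUV⟩ :=
    isOpen_prod_iff.1 hclosed.isOpen_compl _ _ hnotMem
  obtain ⟨g, hg₀, hg⟩ := hfA Uᶜ hU.isClosed_compl (p τ₀) (not_not.2 hpU)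
  obtain ⟨a, ha₀, ha⟩ := hA Vᶜ hV.isClosed_compl (q τ₀) (not_not.2 hqV)
  obtain ⟨b, hb⟩ := hconst a
  refine ⟨g * b, ?_, fun τ hτ => ?_⟩
  · rw [map_mul, (hpq τ₀).apply_scalar, (hpq τ₀).apply_const hb]
    exact mul_ne_zero hg₀ ha₀
  · rw [map_mul, (hpq τ).apply_scalar, (hpq τ).apply_const hb]
    by_cases h : p τ ∈ U
    · rw [ha _ fun h' => hUV (Set.mk_mem_prod h h') ⟨τ, hτ, rfl⟩, mul_zero]
    · rw [hg _ h, zero_mul]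
end

section
/- Let X be a compact Hausdorff space, A a semisimple commutative unital Banach algebra, and 𝑨 an admissible Banach A-valued function algebra on X with 𝔄 = 𝑨 ∩ C(X), such that every character of 𝑨 is of the form ψ⋄φ with ψ ∈ Φ(𝔄), φ ∈ Φ(A). If 𝔄 and A admit bounded relative units, then 𝑨 admits bounded relative units (with constant M_ψ + M_φ + M_ψ·M_φ at the character ψ⋄φ). -/
open WeakDual Topology

namespace VV

/-- The character of `A` obtained by composing a character of `B` with a continuous
algebra homomorphism `A → B`. -/
noncomputable def comapCharacter {A B : Type*} [NormedCommRing A] [NormedAlgebra ℂ A]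
    [NormedCommRing B] [NormedAlgebra ℂ B] (j : A →ₐ[ℂ] B) (hj : Continuous j)
    (τ : characterSpace ℂ B) : characterSpace ℂ A :=
  ⟨StrongDual.toWeakDual ((WeakDual.toStrongDual (τ : WeakDual ℂ B)).comp ⟨j.toLinearMap, hj⟩), by
    constructor
    · intro h
      have h1 : τ (j 1) = 0 := congrArg (fun f : WeakDual ℂ A => f 1) h
      rw [map_one, map_one] at h1
      exact one_ne_zero h1
    · intro a b
      change τ (j (a * b)) = τ (j a) * τ (j b)
      rw [map_mul, map_mul]⟩

theorem comapCharacter_apply {A B : Type*} [NormedCommRing A] [NormedAlgebra ℂ A]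
    [NormedCommRing B] [NormedAlgebra ℂ B] (j : A →ₐ[ℂ] B) (hj : Continuous j)
    (τ : characterSpace ℂ B) (a : A) : comapCharacter j hj τ a = τ (j a) := rfl

theorem continuous_comapCharacter {A B : Type*} [NormedCommRing A] [NormedAlgebra ℂ A]
    [NormedCommRing B] [NormedAlgebra ℂ B] (j : A →ₐ[ℂ] B) (hj : Continuous j) :
    Continuous (comapCharacter j hj) :=
  Continuous.subtype_mk (WeakDual.continuous_of_continuous_eval fun a =>
    (WeakDual.eval_continuous (j a)).comp continuous_subtype_val) _

/-- If `A` is semisimple, the embedding of `A` into an `A`-valued function algebra as the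
constant functions is a continuous homomorphism. -/
theorem exists_continuous_const_algHom
    {X : Type*} [TopologicalSpace X] [CompactSpace X] [T2Space X]
    {A : Type*} [NormedCommRing A] [NormedAlgebra ℂ A] [CompleteSpace A] [Nontrivial A]
    (hss : IsSemisimple A)
    {B : Type*} [NormedCommRing B] [NormedAlgebra ℂ B] [CompleteSpace B] [Nontrivial B]
    (ι : B →ₐ[ℂ] C(X, A)) (hinj : Function.Injective ι) (hconst : ContainsConstants X A B ι) :
    ∃ j : A →ₐ[ℂ] B, Continuous j ∧ ∀ a x, ι (j a) x = a := by
  choose k hk using hconst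
  let j : A →ₐ[ℂ] B :=
    { toFun := k
      map_one' := hinj (by ext x; simp [hk])
      map_mul' := fun a b => hinj (by ext x; simp [hk])
      map_zero' := hinj (by ext x; simp [hk])
      map_add' := fun a b => hinj (by ext x; simp [hk])
      commutes' := fun c => hinj (by ext x; simp [hk, Algebra.algebraMap_eq_smul_one]) }
  refine ⟨j, ?_, hk⟩
  refine LinearMap.continuous_of_seq_closed_graph (g := j.toLinearMap) fun u a b hu hb => ?_
  refine hinj (ContinuousMap.ext fun x => ?_)
  change ι b x = ι (k a) x
  rw [hk, ← sub_eq_zero]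
  refine hss _ fun φ => ?_
  let χ : B →ₐ[ℂ] ℂ := ((CharacterSpace.toAlgHom φ).comp
    (ContinuousMap.evalAlgHom ℂ A x)).comp ι
  have hχ : Continuous χ := map_continuous χ
  have h1 : Filter.Tendsto (fun n => φ (u n)) Filter.atTop (𝓝 (χ b)) := by
    refine ((hχ.tendsto b).comp hb).congr fun n => ?_
    change φ (ι (k (u n)) x) = φ (u n)
    rw [hk]
  have h2 : Filter.Tendsto (fun n => φ (u n)) Filter.atTop (𝓝 (φ a)) :=
    ((map_continuous φ).tendsto a).comp hu
  have h3 : φ (ι b x) = φ a := tendsto_nhds_unique h1 h2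
  rw [map_sub, h3, sub_self]

/-- Bounded relative units transfer along a pair of continuous homomorphisms into `B` which
together separate the characters of `B`. -/
theorem HasBRU.of_separating_pair {A C B : Type*} [NormedCommRing A] [NormedAlgebra ℂ A]
    [NormedCommRing C] [NormedAlgebra ℂ C] [NormedCommRing B] [NormedAlgebra ℂ B]
    (hC : HasBRU C) (hA : HasBRU A) (i : C →ₐ[ℂ] B) (hi : Continuous i)
    (j : A →ₐ[ℂ] B) (hj : Continuous j)
    (hsep : ∀ σ τ : characterSpace ℂ B, comapCharacter i hi σ = comapCharacter i hi τ →
      comapCharacter j hj σ = comapCharacter j hj τ → σ = τ) :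
    HasBRU B := by
  intro τ
  let p := comapCharacter i hi
  let q := comapCharacter j hj
  have hp : Continuous p := continuous_comapCharacter i hi
  have hq : Continuous q := continuous_comapCharacter j hj
  obtain ⟨M, hM, hu⟩ := hC (p τ)
  obtain ⟨N, hN, hv⟩ := hA (q τ)
  let I : C →L[ℂ] B := ⟨i.toLinearMap, hi⟩
  let L : A →L[ℂ] B := ⟨j.toLinearMap, hj⟩
  refine ⟨‖I‖ * M + ‖L‖ * N + ‖I‖ * M * (‖L‖ * N) + 1, by positivity, fun K hK hτK => ?_⟩
  have hpq : Continuous fun σ => (p σ, q σ) := hp.prodMk hq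
  have hmem : ((fun σ => (p σ, q σ)) '' K)ᶜ ∈ 𝓝 (p τ, q τ) := by
    refine (hK.image hpq).isClosed.isOpen_compl.mem_nhds ?_
    rintro ⟨σ, hσ, h⟩
    exact hτK (hsep σ τ (congrArg Prod.fst h) (congrArg Prod.snd h) ▸ hσ)
  obtain ⟨U, V, hUo, hτU, hVo, hτV, hUV⟩ := mem_nhds_prod_iff'.mp hmem
  obtain ⟨u, ⟨U', hU', hu0⟩, hu1, hun⟩ := hu (p '' (K ∩ p ⁻¹' Uᶜ))
    ((hK.inter_right (hUo.isClosed_compl.preimage hp)).image hp) (by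
      rintro ⟨σ, ⟨-, hσ⟩, h⟩
      exact hσ (h ▸ hτU))
  obtain ⟨v, ⟨V', hV', hv0⟩, hv1, hvn⟩ := hv (q '' (K ∩ q ⁻¹' Vᶜ))
    ((hK.inter_right (hVo.isClosed_compl.preimage hq)).image hq) (by
      rintro ⟨σ, ⟨-, hσ⟩, h⟩
      exact hσ (h ▸ hτV))
  refine ⟨i u + j v - i u * j v, ⟨p ⁻¹' U' ∩ q ⁻¹' V',
    Filter.inter_mem (hp.continuousAt hU') (hq.continuousAt hV'), ?_⟩, ?_, ?_⟩
  · rintro σ ⟨h1, h2⟩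
    have hσu : σ (i u) = 0 := hu0 _ h1
    have hσv : σ (j v) = 0 := hv0 _ h2
    simp [hσu, hσv]
  · intro σ hσ
    by_cases hσU : p σ ∈ U
    · have hσV : q σ ∉ V := fun h => hUV (Set.mk_mem_prod hσU h) ⟨σ, hσ, rfl⟩
      have hσv : σ (j v) = 1 := hv1 _ ⟨σ, ⟨hσ, hσV⟩, rfl⟩
      simp [hσv]
    · have hσu : σ (i u) = 1 := hu1 _ ⟨σ, ⟨hσ, hσU⟩, rfl⟩
      simp [hσu]
  · have hiu : ‖i u‖ ≤ ‖I‖ * M := I.le_opNorm_of_le hun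
    have hjv : ‖j v‖ ≤ ‖L‖ * N := L.le_opNorm_of_le hvn
    have hmul : ‖i u * j v‖ ≤ ‖I‖ * M * (‖L‖ * N) :=
      (norm_mul_le _ _).trans (mul_le_mul hiu hjv (norm_nonneg _) (by positivity))
    linarith [norm_sub_le (i u + j v) (i u * j v), norm_add_le (i u) (j v)]

end VV

theorem bru_of_components
    (X : Type*) [TopologicalSpace X] [CompactSpace X] [T2Space X]
    (A : Type*) [NormedCommRing A] [NormedAlgebra ℂ A] [CompleteSpace A] [Nontrivial A]
    (hss : VV.IsSemisimple A)
    (B : Type*) [NormedCommRing B] [NormedAlgebra ℂ B] [CompleteSpace B] [Nontrivial B]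
    (ι : B →ₐ[ℂ] C(X, A)) (hinj : Function.Injective ι)
    (hconst : VV.ContainsConstants X A B ι) (hsep : VV.Separates X A B ι)
    (hadm : VV.Admissible X A B ι) (hnat : VV.NaturalProduct X A B ι)
    (hfA : VV.HasBRU (VV.scalarSub X A B ι)) (hA : VV.HasBRU A) :
    VV.HasBRU B := by
  obtain ⟨j, hj, hjι⟩ := VV.exists_continuous_const_algHom hss ι hinj hconst
  refine hfA.of_separating_pair hA (VV.scalarSub X A B ι).val continuous_subtype_val j hj
    fun σ τ hp hq => ?_
  have key : ∀ σ : characterSpace ℂ B, ∀ f : B, ∀ g : VV.scalarSub X A B ι,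
      (∀ x, ι (g : B) x = algebraMap ℂ A (VV.comapCharacter j hj σ (ι f x))) → σ f = σ g := by
    intro σ f g hg
    obtain ⟨ψ, φ, h⟩ := hnat σ
    have hφ : VV.comapCharacter j hj σ = φ := by
      refine CharacterSpace.ext fun a => ?_
      rw [VV.comapCharacter_apply,
        h (j a) (algebraMap ℂ _ (φ a)) fun x => by
          simp [hjι, Algebra.algebraMap_eq_smul_one], AlgHomClass.commutes]
      rfl
    have hψ : σ (g : B) = ψ g := h _ _ fun x => by
      rw [hg, AlgHomClass.commutes]
      rfl
    rw [hψ]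
    exact h f g fun x => by rw [hg, hφ]
  refine CharacterSpace.ext fun f => ?_
  obtain ⟨g, hg⟩ := hadm f (VV.comapCharacter j hj σ)
  let g' : VV.scalarSub X A B ι := ⟨g, fun x => ⟨_, hg x⟩⟩
  rw [key σ f g' hg, key τ f g' (hq ▸ hg)]
  exact congrArg (fun χ : characterSpace ℂ (VV.scalarSub X A B ι) => χ g') hp
end

section
/- Let X be a compact Hausdorff space, A a semisimple commutative unital Banach algebra, and 𝑨 an admissible Banach A-valued function algebra on X with 𝔄 = 𝑨 ∩ C(X), such that every character of 𝑨 is of the form ψ⋄φ with ψ ∈ Φ(𝔄), φ ∈ Φ(A). Suppose the subalgebra 𝔄A generated by 𝔄 ∪ A (consisting of all functions f = Σ_{i=1}^n f_i a_i with f_i ∈ 𝔄, a_i ∈ A) is dense in 𝑨. If 𝔄 and A are strong Ditkin algebras, then 𝑨 is a strong Ditkin algebra. -/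
open WeakDual Topology

namespace VV

open Filter

/-- The pullback of a character along a continuous algebra homomorphism. -/
noncomputable def pullChar {A B : Type*} [NormedCommRing A] [NormedAlgebra ℂ A]
    [NormedCommRing B] [NormedAlgebra ℂ B] (k : A →ₐ[ℂ] B) (hk : Continuous k)
    (τ : characterSpace ℂ B) : characterSpace ℂ A :=
  ⟨(CharacterSpace.toCLM τ).comp ⟨k.toLinearMap, hk⟩, by
    rw [CharacterSpace.eq_set_map_one_map_mul]
    exact ⟨(congrArg τ (map_one k)).trans (map_one τ),
      fun x y => (congrArg τ (map_mul k x y)).trans (map_mul τ _ _)⟩⟩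

theorem continuous_pullChar {A B : Type*} [NormedCommRing A] [NormedAlgebra ℂ A]
    [NormedCommRing B] [NormedAlgebra ℂ B] (k : A →ₐ[ℂ] B) (hk : Continuous k) :
    Continuous (pullChar k hk) :=
  Continuous.subtype_mk (WeakDual.continuous_of_continuous_eval fun a =>
    (WeakDual.eval_continuous (k a)).comp continuous_subtype_val) _

theorem map_mem_Jid_s18 {A B : Type*} [NormedCommRing A] [NormedAlgebra ℂ A]
    [NormedCommRing B] [NormedAlgebra ℂ B] (k : A →ₐ[ℂ] B) (hk : Continuous k)
    (τ : characterSpace ℂ B) {a : A} (ha : a ∈ Jid A (pullChar k hk τ)) :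
    k a ∈ Jid B τ := by
  obtain ⟨U, hU, h⟩ := ha
  exact ⟨_, (continuous_pullChar k hk).continuousAt hU, fun χ hχ => h _ hχ⟩

theorem Jid_subset_Iid {B : Type*} [NormedCommRing B] [NormedAlgebra ℂ B]
    (ψ : characterSpace ℂ B) : Jid B ψ ⊆ Iid B ψ :=
  fun _ ⟨_, hU, h⟩ => h ψ (mem_of_mem_nhds hU)

/-- The circle operation `u + v - u v` preserves `J_ψ`. -/
theorem circle_mem_Jid {B : Type*} [NormedCommRing B] [NormedAlgebra ℂ B]
    {ψ : characterSpace ℂ B} {u v : B} (hu : u ∈ Jid B ψ) (hv : v ∈ Jid B ψ) :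
    u + v - u * v ∈ Jid B ψ := by
  obtain ⟨U, hU, h⟩ := hu
  obtain ⟨V, hV, h'⟩ := hv
  refine ⟨U ∩ V, inter_mem hU hV, fun χ hχ => ?_⟩
  simp [h χ hχ.1, h' χ hχ.2]

/-- If single elements of `I_ψ` have approximate units in a bounded family in `I_ψ`,
then so do finite sets (with no bound on the approximate unit). -/
theorem exists_approx_unit_finset {B κ : Type*} [NormedCommRing B] [NormedAlgebra ℂ B]
    {ψ : characterSpace ℂ B} {u : κ → B} {M : ℝ} (hu : ∀ i, u i ∈ Iid B ψ)
    (hM : ∀ i, ‖u i‖ ≤ M)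
    (h : ∀ b ∈ Iid B ψ, ∀ ε : ℝ, 0 < ε → ∃ i, ‖b * u i - b‖ < ε)
    (F : Finset (Iid B ψ)) :
    ∀ ε : ℝ, 0 < ε → ∃ v ∈ Iid B ψ, ∀ b ∈ F, ‖(b : B) * v - b‖ < ε := by
  classical
  induction F using Finset.induction_on with
  | empty => exact fun ε _ => ⟨0, map_zero ψ, by simp⟩
  | insert b F _ ih =>
    intro ε hε
    have hC : ∀ i, ‖1 - u i‖ < ‖(1 : B)‖ + |M| + 1 := fun i =>
      (norm_sub_le _ _).trans_lt (by linarith [hM i, le_abs_self M])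
    set C := ‖(1 : B)‖ + |M| + 1
    have hC0 : 0 < C := by positivity
    obtain ⟨v, hv, hvF⟩ := ih (ε / C) (by positivity)
    obtain ⟨i, hi⟩ := h b b.2 (ε / (‖1 - v‖ + 1)) (by positivity)
    refine ⟨u i + v - u i * v, ?_, fun c hc => ?_⟩
    · have h1 : ψ (u i) = 0 := hu i
      have h2 : ψ v = 0 := hv
      simp [Iid, h1, h2]
    rcases Finset.mem_insert.1 hc with rfl | hc
    · calc ‖(c : B) * (u i + v - u i * v) - c‖
          = ‖((c : B) * u i - c) * (1 - v)‖ := by congr 1; ring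
        _ ≤ ‖(c : B) * u i - c‖ * ‖1 - v‖ := norm_mul_le _ _
        _ ≤ ‖(c : B) * u i - c‖ * (‖1 - v‖ + 1) := by gcongr; linarith
        _ < ε := (lt_div_iff₀ (by positivity)).1 hi
    · calc ‖(c : B) * (u i + v - u i * v) - c‖
          = ‖((c : B) * v - c) * (1 - u i)‖ := by congr 1; ring
        _ ≤ ‖(c : B) * v - c‖ * ‖1 - u i‖ := norm_mul_le _ _
        _ ≤ ‖(c : B) * v - c‖ * C := by gcongr; exact (hC i).le
        _ < ε := (lt_div_iff₀ hC0).1 (hvF c hc)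

/-- If single elements of `I_ψ` have approximate units in a bounded family in `I_ψ`,
then finite subsets have approximate units in the same family. -/
theorem exists_index_approx_unit_finset {B κ : Type*} [NormedCommRing B] [NormedAlgebra ℂ B]
    {ψ : characterSpace ℂ B} {u : κ → B} {M : ℝ} (hu : ∀ i, u i ∈ Iid B ψ)
    (hM : ∀ i, ‖u i‖ ≤ M)
    (h : ∀ b ∈ Iid B ψ, ∀ ε : ℝ, 0 < ε → ∃ i, ‖b * u i - b‖ < ε)
    (F : Finset (Iid B ψ)) (ε : ℝ) (hε : 0 < ε) :
    ∃ i, ∀ b ∈ F, ‖(b : B) * u i - b‖ < ε := by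
  have hC : ∀ i, ‖1 - u i‖ ≤ ‖(1 : B)‖ + |M| + 1 := fun i =>
    (norm_sub_le _ _).trans (by linarith [hM i, le_abs_self M])
  set C := ‖(1 : B)‖ + |M| + 1
  have hC0 : 0 < C := by positivity
  obtain ⟨v, hv, hvF⟩ := exists_approx_unit_finset hu hM h F (ε / 2 / C) (by positivity)
  set S := ∑ b ∈ F, ‖(b : B)‖
  have hS : ∀ b ∈ F, ‖(b : B)‖ ≤ S := fun b hb =>
    Finset.single_le_sum (f := fun b : Iid B ψ => ‖(b : B)‖) (fun _ _ => norm_nonneg _) hb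
  have hS0 : 0 ≤ S := Finset.sum_nonneg fun _ _ => norm_nonneg _
  obtain ⟨i, hi⟩ := h v hv (ε / 2 / (S + 1)) (by positivity)
  refine ⟨i, fun b hb => ?_⟩
  have h1 : ‖(b : B) * v - b‖ * C < ε / 2 := (lt_div_iff₀ hC0).1 (hvF b hb)
  have h2 : ‖v * u i - v‖ * (S + 1) < ε / 2 := (lt_div_iff₀ (by positivity)).1 hi
  calc ‖(b : B) * u i - b‖
      = ‖((b : B) * v - b) * (1 - u i) + (v * u i - v) * b‖ := by congr 1; ring
    _ ≤ ‖(b : B) * v - b‖ * ‖1 - u i‖ + ‖v * u i - v‖ * ‖(b : B)‖ :=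
        (norm_add_le _ _).trans (add_le_add (norm_mul_le _ _) (norm_mul_le _ _))
    _ ≤ ‖(b : B) * v - b‖ * C + ‖v * u i - v‖ * (S + 1) := by
        gcongr
        · exact hC i
        · linarith [hS b hb]
    _ < ε := by linarith

/-- The strong Ditkin condition in terms of filters. -/
theorem strongDitkinAt_iff_exists_filter {B : Type*} [NormedCommRing B] [NormedAlgebra ℂ B]
    {ψ : characterSpace ℂ B} :
    StrongDitkinAt B ψ ↔ ∃ (κ : Type) (l : Filter κ) (u : κ → B) (M : ℝ), l.NeBot ∧
      (∀ i, u i ∈ Jid B ψ) ∧ (∀ i, ‖u i‖ ≤ M) ∧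
      ∀ b ∈ Iid B ψ, Tendsto (fun i => b * u i - b) l (𝓝 0) := by
  constructor
  · rintro ⟨κ, le, u, M, -, hdir, hJ, hM, happ⟩
    have h1 : ∀ b ∈ Iid B ψ, ∀ ε : ℝ, 0 < ε → ∃ i, ‖b * u i - b‖ < ε := by
      intro b hb ε hε
      obtain ⟨i, hi⟩ := happ b hb ε hε
      obtain ⟨k, hk, -⟩ := hdir i i
      exact ⟨k, hi k hk⟩
    have hI : ∀ i, u i ∈ Iid B ψ := fun i => Jid_subset_Iid ψ (hJ i)
    let T : κ → (Iid B ψ → B) := fun i b => b * u i - b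
    refine ⟨κ, comap T (𝓝 0), u, M, ?_, hJ, hM, fun b hb => ?_⟩
    · refine comap_neBot fun t ht => ?_
      rw [nhds_pi, mem_pi'] at ht
      obtain ⟨F, s, hs, hst⟩ := ht
      have hball : ∀ᶠ ε in 𝓝[>] (0 : ℝ), ∀ b ∈ F, Metric.ball 0 ε ⊆ s b := by
        refine F.eventually_all.2 fun b _ => ?_
        obtain ⟨δ, hδ, hδs⟩ := Metric.mem_nhds_iff.1 (hs b)
        filter_upwards [Ioo_mem_nhdsGT hδ] with ε hε
        exact (Metric.ball_subset_ball hε.2.le).trans hδs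
      obtain ⟨ε, hεF, hε⟩ := (hball.and self_mem_nhdsWithin).exists
      obtain ⟨i, hi⟩ := exists_index_approx_unit_finset hI hM h1 F ε hε
      exact ⟨i, hst fun b hb => hεF b hb (mem_ball_zero_iff.2 (hi b hb))⟩
    · have hT : Tendsto T (comap T (𝓝 0)) (𝓝 0) := tendsto_comap
      exact tendsto_pi_nhds.1 hT ⟨b, hb⟩
  · rintro ⟨κ, l, u, M, hl, hJ, hM, happ⟩
    obtain ⟨i₀⟩ := l.nonempty_of_neBot
    refine ⟨{p : Set κ × κ // p.1 ∈ l ∧ p.2 ∈ p.1}, fun p q => q.1.1 ⊆ p.1.1,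
      fun p => u p.1.2, M, ⟨⟨(Set.univ, i₀), univ_mem, trivial⟩⟩, fun p q => ?_,
      fun p => hJ _, fun p => hM _, fun b hb ε hε => ?_⟩
    · have hpq := inter_mem p.2.1 q.2.1
      obtain ⟨k, hk⟩ := l.nonempty_of_mem hpq
      exact ⟨⟨(_, k), hpq, hk⟩, Set.inter_subset_left, Set.inter_subset_right⟩
    · have hS : {i | ‖b * u i - b‖ < ε} ∈ l := by
        have := (happ b hb).norm
        rw [norm_zero] at this
        exact this (gt_mem_nhds hε)
      obtain ⟨k, hk⟩ := l.nonempty_of_mem hS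
      exact ⟨⟨(_, k), hS, hk⟩, fun q hq => hq q.2.2⟩

theorem tendsto_sub_mul_one_sub {A B κ : Type*} [NormedCommRing A] [NormedAlgebra ℂ A]
    [NormedCommRing B] [NormedAlgebra ℂ B] (k : A →ₐ[ℂ] B) (hk : Continuous k)
    {τ : characterSpace ℂ B} {l : Filter κ} {u : κ → A}
    (happ : ∀ a ∈ Iid A (pullChar k hk τ), Tendsto (fun i => a * u i - a) l (𝓝 0)) (a : A) :
    Tendsto (fun i => (k a - τ (k a) • 1) * (1 - k (u i))) l (𝓝 0) := by
  have hmem : a - algebraMap ℂ A (τ (k a)) ∈ Iid A (pullChar k hk τ) := by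
    change τ (k _) = 0
    rw [map_sub, map_sub, AlgHom.commutes]
    exact sub_eq_zero.2 (AlgHomClass.commutes τ _).symm
  have ht := ((hk.tendsto' 0 0 (map_zero k)).comp (happ _ hmem)).neg
  rw [neg_zero] at ht
  refine ht.congr fun i => ?_
  simp only [Function.comp_apply, map_sub, map_mul, AlgHom.commutes, Algebra.smul_def, mul_one]
  ring

/-- The strong Ditkin condition passes to a commutative Banach algebra from two algebras whose
images generate a dense subalgebra. -/
theorem StrongDitkinAt.of_dense_span {A₁ A₂ B : Type*} [NormedCommRing A₁] [NormedAlgebra ℂ A₁]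
    [NormedCommRing A₂] [NormedAlgebra ℂ A₂] [NormedCommRing B] [NormedAlgebra ℂ B]
    (k₁ : A₁ →ₐ[ℂ] B) (hk₁ : Continuous k₁) (k₂ : A₂ →ₐ[ℂ] B) (hk₂ : Continuous k₂)
    (hdense : Dense (Submodule.span ℂ
      (Set.range fun p : A₁ × A₂ => k₁ p.1 * k₂ p.2) : Set B))
    {τ : characterSpace ℂ B} (h₁ : StrongDitkinAt A₁ (pullChar k₁ hk₁ τ))
    (h₂ : StrongDitkinAt A₂ (pullChar k₂ hk₂ τ)) : StrongDitkinAt B τ := by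
  rw [strongDitkinAt_iff_exists_filter] at *
  obtain ⟨κ₁, l₁, u, M₁, hl₁, hJ₁, hM₁, happ₁⟩ := h₁
  obtain ⟨κ₂, l₂, v, M₂, hl₂, hJ₂, hM₂, happ₂⟩ := h₂
  let K₁ : A₁ →L[ℂ] B := ⟨k₁.toLinearMap, hk₁⟩
  let K₂ : A₂ →L[ℂ] B := ⟨k₂.toLinearMap, hk₂⟩
  have hu : ∀ i, ‖k₁ (u i)‖ ≤ ‖K₁‖ * M₁ := fun i => K₁.le_opNorm_of_le (hM₁ i)
  have hv : ∀ j, ‖k₂ (v j)‖ ≤ ‖K₂‖ * M₂ := fun j => K₂.le_opNorm_of_le (hM₂ j)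
  set N₁ := ‖K₁‖ * M₁
  set N₂ := ‖K₂‖ * M₂
  have hu' : ∀ i, ‖1 - k₁ (u i)‖ ≤ ‖(1 : B)‖ + N₁ := fun i =>
    (norm_sub_le _ _).trans (by linarith [hu i])
  have hv' : ∀ j, ‖1 - k₂ (v j)‖ ≤ ‖(1 : B)‖ + N₂ := fun j =>
    (norm_sub_le _ _).trans (by linarith [hv j])
  let R : κ₁ × κ₂ → B := fun p => (1 - k₁ (u p.1)) * (1 - k₂ (v p.2))
  set C := (‖(1 : B)‖ + N₁) * (‖(1 : B)‖ + N₂)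
  have hR : ∀ p, ‖R p‖ ≤ C := fun p => (norm_mul_le _ _).trans
    (mul_le_mul (hu' _) (hv' _) (norm_nonneg _) ((norm_nonneg _).trans (hu' p.1)))
  let D : B →L[ℂ] B := ContinuousLinearMap.id ℂ B - (CharacterSpace.toCLM τ).smulRight 1
  have hD : ∀ b, D b = b - τ b • 1 := fun b => rfl
  have hspan : ∀ b ∈ Submodule.span ℂ (Set.range fun p : A₁ × A₂ => k₁ p.1 * k₂ p.2),
      Tendsto (fun p => D b * R p) (l₁ ×ˢ l₂) (𝓝 0) := by
    intro b hb
    induction hb using Submodule.span_induction with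
    | mem b hb =>
      obtain ⟨⟨g, a⟩, rfl⟩ := hb
      have t₁ := ((tendsto_sub_mul_one_sub k₁ hk₁ happ₁ g).comp
        (tendsto_fst (f := l₁) (g := l₂))).zero_mul_isBoundedUnder_le
        (g := fun p => k₂ a * (1 - k₂ (v p.2)))
        (isBoundedUnder_of ⟨‖k₂ a‖ * (‖(1 : B)‖ + N₂), fun p =>
          (norm_mul_le _ _).trans (mul_le_mul_of_nonneg_left (hv' _) (norm_nonneg _))⟩)
      have t₂ := ((tendsto_sub_mul_one_sub k₂ hk₂ happ₂ a).comp
        (tendsto_snd (f := l₁) (g := l₂))).zero_mul_isBoundedUnder_le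
        (g := fun p => algebraMap ℂ B (τ (k₁ g)) * (1 - k₁ (u p.1)))
        (isBoundedUnder_of ⟨‖algebraMap ℂ B (τ (k₁ g))‖ * (‖(1 : B)‖ + N₁), fun p =>
          (norm_mul_le _ _).trans (mul_le_mul_of_nonneg_left (hu' _) (norm_nonneg _))⟩)
      refine (add_zero (0 : B) ▸ t₁.add t₂).congr fun p => ?_
      simp only [Function.comp_apply, hD, R, map_mul, Algebra.smul_def, mul_one]
      ring
    | zero => simp
    | add x y _ _ hx hy => simpa [add_mul] using hx.add hy
    | smul c x _ hx => simpa using hx.const_smul c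
  refine ⟨κ₁ × κ₂, l₁ ×ˢ l₂,
    fun p => k₁ (u p.1) + k₂ (v p.2) - k₁ (u p.1) * k₂ (v p.2),
    N₁ + N₂ + N₁ * N₂, inferInstance,
    fun p => circle_mem_Jid (map_mem_Jid_s18 k₁ hk₁ τ (hJ₁ _)) (map_mem_Jid_s18 k₂ hk₂ τ (hJ₂ _)),
    fun p => ?_, fun b hb => ?_⟩
  · have h := mul_le_mul (hu p.1) (hv p.2) (norm_nonneg _) ((norm_nonneg _).trans (hu p.1))
    exact (norm_sub_le _ _).trans (add_le_add ((norm_add_le _ _).trans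
      (add_le_add (hu _) (hv _))) ((norm_mul_le _ _).trans h))
  · have hDb : D b = b := by
      have : τ b = 0 := hb
      simp [hD, this]
    have hlim : Tendsto (fun p => D b * R p) (l₁ ×ˢ l₂) (𝓝 0) := by
      have hC0 : 0 ≤ C := by
        obtain ⟨p⟩ := (l₁ ×ˢ l₂).nonempty_of_neBot
        exact (norm_nonneg _).trans (hR p)
      rw [NormedAddGroup.tendsto_nhds_zero]
      intro ε hε
      obtain ⟨s, hs, hsb⟩ := hdense.exists_mem_open
        (Metric.isOpen_ball.preimage (D.continuous.comp (continuous_const.sub continuous_id)))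
        (⟨b, by simp; positivity⟩ :
          ((fun s => D (b - s)) ⁻¹' Metric.ball 0 (ε / 2 / (C + 1))).Nonempty)
      have hsb' : ‖D (b - s)‖ < ε / 2 / (C + 1) := mem_ball_zero_iff.1 hsb
      filter_upwards [NormedAddGroup.tendsto_nhds_zero.1 (hspan s hs) (ε / 2) (by positivity)]
        with p hp
      have h1 : ‖D (b - s)‖ * (C + 1) < ε / 2 := (lt_div_iff₀ (by positivity)).1 hsb'
      calc ‖D b * R p‖ = ‖D (b - s) * R p + D s * R p‖ := by rw [← add_mul, ← map_add]; simp
        _ ≤ ‖D (b - s)‖ * ‖R p‖ + ‖D s * R p‖ :=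
          (norm_add_le _ _).trans (by gcongr; exact norm_mul_le _ _)
        _ ≤ ‖D (b - s)‖ * (C + 1) + ‖D s * R p‖ := by gcongr; linarith [hR p]
        _ < ε := by linarith
    refine (neg_zero (G := B) ▸ hlim.neg).congr fun p => ?_
    simp only [hDb, R]
    ring

/-- A homomorphism `k : A → B` into a valued function algebra on `X` taking each `a` to the
constant function `a` is continuous. -/
theorem continuous_of_const {X A B : Type*} [TopologicalSpace X]
    [NormedCommRing A] [NormedAlgebra ℂ A] [CompleteSpace A] (hss : IsSemisimple A)
    [NormedCommRing B] [NormedAlgebra ℂ B] [CompleteSpace B]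
    (ι : B →ₐ[ℂ] C(X, A)) (hinj : Function.Injective ι) (k : A →ₐ[ℂ] B)
    (hk : ∀ a x, ι (k a) x = a) : Continuous k := by
  refine k.toLinearMap.continuous_of_seq_closed_graph fun s a b hs hks => hinj ?_
  ext x
  refine sub_eq_zero.1 (hss _ fun φ => ?_)
  let χ : B →ₐ[ℂ] ℂ := ((CharacterSpace.toAlgHom φ).comp
    (ContinuousMap.evalAlgHom ℂ A x)).comp ι
  have h1 : Tendsto (fun n => χ (k (s n))) atTop (𝓝 (χ b)) :=
    (χ.toContinuousLinearMap.continuous.tendsto b).comp hks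
  have h2 : Tendsto (fun n => χ (k (s n))) atTop (𝓝 (φ a)) := by
    have : ∀ n, χ (k (s n)) = φ (s n) := fun n => congrArg φ (hk (s n) x)
    simp only [this]
    exact ((map_continuous φ).tendsto a).comp hs
  have h3 : φ (ι b x) = φ a := tendsto_nhds_unique h1 h2
  rw [map_sub, h3, sub_eq_zero]
  exact congrArg φ (hk a x).symm

/-- The embedding of `A` in a valued function algebra as the constant functions. -/
theorem exists_const_algHom {X A B : Type*} [TopologicalSpace X] [CompactSpace X] [T2Space X]
    [NormedCommRing A] [NormedAlgebra ℂ A] [CompleteSpace A] [Nontrivial A]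
    [NormedCommRing B] [NormedAlgebra ℂ B] [CompleteSpace B] [Nontrivial B]
    (ι : B →ₐ[ℂ] C(X, A)) (hinj : Function.Injective ι) (hconst : ContainsConstants X A B ι) :
    ∃ k : A →ₐ[ℂ] B, ∀ a x, ι (k a) x = a := by
  choose k hk using hconst
  refine ⟨
    { toFun := k
      map_one' := ?_
      map_mul' := fun _ _ => ?_
      map_zero' := ?_
      map_add' := fun _ _ => ?_
      commutes' := fun _ => ?_ }, hk⟩
  all_goals
    apply hinj
    ext x
    simp [hk, Algebra.algebraMap_eq_smul_one]

end VV

theorem strongDitkin_of_components_dense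
    (X : Type*) [TopologicalSpace X] [CompactSpace X] [T2Space X]
    (A : Type*) [NormedCommRing A] [NormedAlgebra ℂ A] [CompleteSpace A] [Nontrivial A]
    (hss : VV.IsSemisimple A)
    (B : Type*) [NormedCommRing B] [NormedAlgebra ℂ B] [CompleteSpace B] [Nontrivial B]
    (ι : B →ₐ[ℂ] C(X, A)) (hinj : Function.Injective ι)
    (hconst : VV.ContainsConstants X A B ι) (hsep : VV.Separates X A B ι)
    (hadm : VV.Admissible X A B ι) (hnat : VV.NaturalProduct X A B ι)
    (hdense : Dense {f : B | ∃ (n : ℕ) (g : Fin n → (VV.scalarSub X A B ι))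
      (b : Fin n → B), (∀ i, ∃ a : A, ∀ x : X, ι (b i) x = a) ∧
        f = ∑ i, ((g i : B) * b i)})
    (hfA : VV.IsStrongDitkin (VV.scalarSub X A B ι)) (hA : VV.IsStrongDitkin A) :
    VV.IsStrongDitkin B := by
  obtain ⟨k, hk⟩ := VV.exists_const_algHom ι hinj hconst
  have hkc := VV.continuous_of_const hss ι hinj k hk
  intro τ
  refine VV.StrongDitkinAt.of_dense_span (VV.scalarSub X A B ι).val continuous_subtype_val k hkc
    (hdense.mono ?_) (hfA _) (hA _)
  rintro _ ⟨n, g, b, hb, rfl⟩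
  refine Submodule.sum_mem _ fun i _ => Submodule.subset_span ?_
  obtain ⟨a, ha⟩ := hb i
  have hab : k a = b i := hinj (by ext x; rw [hk, ha])
  exact ⟨(g i, a), by rw [← hab]; rfl⟩
end
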